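/- arXiv:2404.14438 — 3 statements merged into one kernel-verified Lean document; each statement's English description precedes it below -/
import Mathlib

section
/- Let d ≥ 1 and let ρ, Π be d × d complex matrices such that ρ is positive semidefinite with trace(ρ) = 1, Π is Hermitian (Πᴴ = Π) and idempotent (Π · Π = Π). Suppose ε is a real number with trace(Π · ρ) = 1 − ε (this trace is automatically real, and 0 ≤ ε ≤ 1). Then the matrix D = ρ − Π · ρ · Π is Hermitian, and the sum of the absolute values of its (real) eigenvalues is at most 2√ε; equivalently, (1/2)·‖ρ − Π ρ Π‖₁ ≤ √ε, where ‖·‖₁ denotes the trace norm. -/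
open scoped ComplexOrder

namespace Matrix

variable {m n : Type*} [Fintype m] [Fintype n]

theorem re_trace_conjTranspose_mul_self (A : Matrix m n ℂ) :
    (Aᴴ * A).trace.re = ∑ x : n × m, ‖A x.2 x.1‖ ^ 2 := by
  rw [Fintype.sum_prod_type]
  simp [trace, mul_apply, ← Complex.normSq_eq_norm_sq, Complex.normSq_apply]

/-- Cauchy–Schwarz for the Hilbert–Schmidt inner product, applied to the diagonal entrywise. -/
theorem sum_norm_diag_conjTranspose_mul_le (A B : Matrix m n ℂ) :
    ∑ i, ‖(Aᴴ * B) i i‖ ≤ √(Aᴴ * A).trace.re * √(Bᴴ * B).trace.re := by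
  rw [re_trace_conjTranspose_mul_self, re_trace_conjTranspose_mul_self]
  refine le_trans ?_ (Real.sum_mul_le_sqrt_mul_sqrt Finset.univ
    (fun x : n × m => ‖A x.2 x.1‖) (fun x => ‖B x.2 x.1‖))
  rw [Fintype.sum_prod_type]
  refine Finset.sum_le_sum fun i _ => ?_
  rw [mul_apply]
  exact (norm_sum_le _ _).trans_eq (by simp)

theorem IsHermitian.eigenvalues_eq_diag [DecidableEq n] {A : Matrix n n ℂ} (hA : A.IsHermitian)
    (i : n) :
    (hA.eigenvalues i : ℂ) =
      ((hA.eigenvectorUnitary : Matrix n n ℂ)ᴴ * A *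
        (hA.eigenvectorUnitary : Matrix n n ℂ)) i i := by
  have h := congrFun₂ hA.conjStarAlgAut_star_eigenvectorUnitary i i
  simpa [Unitary.conjStarAlgAut_apply, star_eq_conjTranspose] using h.symm

/-- The trace of `Aᴴ * A` is invariant under right multiplication of `A` by a unitary. -/
theorem trace_conjTranspose_mul_self_mul_unitary [DecidableEq n] (A : Matrix m n ℂ)
    (U : unitaryGroup n ℂ) :
    ((A * (U : Matrix n n ℂ))ᴴ * (A * (U : Matrix n n ℂ))).trace = (Aᴴ * A).trace := by
  have hU : (U : Matrix n n ℂ) * (U : Matrix n n ℂ)ᴴ = 1 := Unitary.coe_mul_star_self U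
  rw [conjTranspose_mul, Matrix.mul_assoc, trace_mul_comm, Matrix.mul_assoc, Matrix.mul_assoc,
    hU, Matrix.mul_one]

theorem trace_conjTranspose_mul_self_mul_projection {P : Matrix n n ℂ} (B : Matrix m n ℂ)
    (hP : P.IsHermitian) (hidem : P * P = P) :
    ((B * P)ᴴ * (B * P)).trace = (P * (Bᴴ * B)).trace := by
  rw [conjTranspose_mul, hP.eq, trace_mul_comm, Matrix.mul_assoc, ← Matrix.mul_assoc P, hidem,
    ← Matrix.mul_assoc, trace_mul_comm, ← Matrix.mul_assoc, trace_mul_comm]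

end Matrix

/-- **Gentle measurement lemma for mixed states** (Lemma 9.4.2 of Wilde).
If `ρ` is a density matrix (PSD with unit trace), `P` is a Hermitian idempotent
(a projector), and `trace (P * ρ) = 1 - ε`, then `D = ρ - P ρ P` is Hermitian and
the sum of the absolute values of its eigenvalues (the trace norm `‖D‖₁`) is at
most `2 √ε`, i.e. `(1/2) ‖ρ - P ρ P‖₁ ≤ √ε`. -/
theorem gentle_measurement_mixed
    {d : ℕ} (hd : 1 ≤ d)
    (ρ P : Matrix (Fin d) (Fin d) ℂ)
    (hρ : ρ.PosSemidef) (htr : ρ.trace = 1)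
    (hP : P.IsHermitian) (hidem : P * P = P)
    (ε : ℝ) (hε : (P * ρ).trace = ((1 - ε : ℝ) : ℂ)) :
    ∃ hD : (ρ - P * ρ * P).IsHermitian,
      ∑ i, |hD.eigenvalues i| ≤ 2 * Real.sqrt ε := by
  have hD : (ρ - P * ρ * P).IsHermitian := by
    refine hρ.isHermitian.sub ?_
    simpa [hP.eq] using Matrix.isHermitian_mul_mul_conjTranspose P hρ.isHermitian
  refine ⟨hD, ?_⟩
  obtain ⟨B, rfl⟩ : ∃ B : Matrix (Fin d) (Fin d) ℂ, ρ = B.conjTranspose * B := by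
    open scoped MatrixOrder in exact CStarAlgebra.nonneg_iff_eq_star_mul_self.mp hρ.nonneg
  set Q := 1 - P with hQdef
  have hQ : Q.IsHermitian := Matrix.isHermitian_one.sub hP
  have hQidem : Q * Q = Q := by
    simp [hQdef, sub_mul, mul_sub, hidem]
  set V := (hD.eigenvectorUnitary : Matrix (Fin d) (Fin d) ℂ)
  have trX : ((B * V).conjTranspose * (B * V)).trace.re = 1 := by
    rw [Matrix.trace_conjTranspose_mul_self_mul_unitary, htr, Complex.one_re]
  have trZ : ((B * P * V).conjTranspose * (B * P * V)).trace.re = 1 - ε := by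
    rw [Matrix.trace_conjTranspose_mul_self_mul_unitary,
      Matrix.trace_conjTranspose_mul_self_mul_projection B hP hidem, hε, Complex.ofReal_re]
  have trY : ((B * Q * V).conjTranspose * (B * Q * V)).trace.re = ε := by
    rw [Matrix.trace_conjTranspose_mul_self_mul_unitary,
      Matrix.trace_conjTranspose_mul_self_mul_projection B hQ hQidem, hQdef, sub_mul, one_mul,
      Matrix.trace_sub, hε, htr]
    simp
  have hε0 : 0 ≤ ε := by
    rw [← trY, Matrix.re_trace_conjTranspose_mul_self]
    positivity
  have hsplit : V.conjTranspose * (B.conjTranspose * B - P * (B.conjTranspose * B) * P) * V =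
      (B * Q * V).conjTranspose * (B * V) + (B * P * V).conjTranspose * (B * Q * V) := by
    simp only [Matrix.conjTranspose_mul, hP.eq, hQ.eq]
    rw [hQdef]
    noncomm_ring
  have hYX := Matrix.sum_norm_diag_conjTranspose_mul_le (B * Q * V) (B * V)
  have hZY := Matrix.sum_norm_diag_conjTranspose_mul_le (B * P * V) (B * Q * V)
  rw [trY, trX, Real.sqrt_one, mul_one] at hYX
  rw [trZ, trY] at hZY
  have hle : √(1 - ε) * √ε ≤ √ε :=
    mul_le_of_le_one_left (Real.sqrt_nonneg ε) (Real.sqrt_le_one.mpr (by linarith))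
  calc ∑ i, |hD.eigenvalues i|
      ≤ ∑ i, (‖((B * Q * V).conjTranspose * (B * V)) i i‖ +
          ‖((B * P * V).conjTranspose * (B * Q * V)) i i‖) := by
        refine Finset.sum_le_sum fun i _ => ?_
        rw [← Real.norm_eq_abs, ← Complex.norm_real, hD.eigenvalues_eq_diag, hsplit,
          Matrix.add_apply]
        exact norm_add_le _ _
    _ ≤ 2 * √ε := by
        rw [Finset.sum_add_distrib]
        linarith
end

section
/- Let q be a prime, and let ℓ, n ≥ 1 be integers. Let C ∈ Matrix (Fin ℓ) (Fin n) (ZMod q) be a moderate matrix, and let d'₁, d'₂ : Fin n → ZMod 2 be distinct vectors, both nonzero. Define g : ((Fin ℓ → ZMod q) × ZMod 2 × ZMod 2) → ℝ by g(v, z₁, z₂) = 2^{−n} · #{s : Fin n → {0,1} : C·s = v and d'₁·s = z₁ and d'₂·s = z₂}, where in C·s the bits of s are cast into ZMod q and in d'ⱼ·s into ZMod 2. Then the total variation distance of g from the uniform density satisfies (1/2) · ∑_{(v, z₁, z₂)} |g(v, z₁, z₂) − 1/(4·q^ℓ)| ≤ q^{ℓ/2} · 2^{−n/40}. -/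
/-- `x ∈ ZMod q` is moderate if its centered representative `r ∈ (-q/2, q/2]`
(i.e. `x.valMinAbs`) satisfies `q/8 < |r| ≤ 3q/8`. -/
def ModerateElem (q : ℕ) (x : ZMod q) : Prop :=
  (q : ℤ) < 8 * |x.valMinAbs| ∧ 8 * |x.valMinAbs| ≤ 3 * (q : ℤ)

/-- A vector over `ZMod q` is moderate if at least a quarter of its entries are
moderate. -/
def ModerateVec (q : ℕ) {n : ℕ} (v : Fin n → ZMod q) : Prop :=
  ∃ M : Finset (Fin n), n ≤ 4 * M.card ∧ ∀ i ∈ M, ModerateElem q (v i)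

/-- A matrix over `ZMod q` is moderate if every nonzero vector in its row span
is moderate. -/
def ModerateMatrix (q : ℕ) {ℓ n : ℕ} (C : Matrix (Fin ℓ) (Fin n) (ZMod q)) : Prop :=
  ∀ x : Fin ℓ → ZMod q, x ≠ 0 → ModerateVec q (Matrix.vecMul x C)

/-- The joint probability density of `(C·s, d'₁·s, d'₂·s)` for `s` uniform on
bit strings `{0,1}ⁿ`. -/
noncomputable def gDensity (q : ℕ) (ℓ n : ℕ)
    (C : Matrix (Fin ℓ) (Fin n) (ZMod q)) (d₁ d₂ : Fin n → ZMod 2)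
    (p : (Fin ℓ → ZMod q) × ZMod 2 × ZMod 2) : ℝ :=
  ((Finset.univ.filter (fun s : Fin n → Fin 2 =>
      C.mulVec (fun i => ((s i : ℕ) : ZMod q)) = p.1 ∧
      (∑ i, d₁ i * ((s i : ℕ) : ZMod 2)) = p.2.1 ∧
      (∑ i, d₂ i * ((s i : ℕ) : ZMod 2)) = p.2.2)).card : ℝ) / 2 ^ n

open Finset in
/-- Parseval: the sum over all characters of the squared character sums of `f` counts collisions. -/
theorem sum_norm_sq_charSum {S G : Type*} [Fintype S] [AddCommGroup G] [Fintype G] [DecidableEq G]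
    (f : S → G) :
    ∑ ψ : AddChar G ℂ, ‖∑ s, ψ (f s)‖ ^ 2
      = Fintype.card G * ∑ p : G, (#{s | f s = p} : ℝ) ^ 2 := by
  have hcoll : ∑ p : G, (#{s | f s = p} : ℂ) ^ 2 = ∑ s, ∑ t, if f s = f t then (1 : ℂ) else 0 := by
    have hcard (p : G) : (#{s | f s = p} : ℂ) = ∑ s, if f s = p then (1 : ℂ) else 0 := by
      simp [Finset.sum_boole]
    simp_rw [hcard, sq, Finset.sum_mul_sum]
    rw [Finset.sum_comm]
    refine Finset.sum_congr rfl fun s _ => ?_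
    rw [Finset.sum_comm]
    refine Finset.sum_congr rfl fun t _ => ?_
    simp [eq_comm]
  have hexp (ψ : AddChar G ℂ) : ((‖∑ s, ψ (f s)‖ : ℂ)) ^ 2 = ∑ s, ∑ t, ψ (f s - f t) := by
    rw [← Complex.mul_conj', map_sum, Finset.sum_mul_sum]
    simp_rw [sub_eq_add_neg, AddChar.map_add_eq_mul, AddChar.map_neg_eq_conj]
  have : ((∑ ψ : AddChar G ℂ, ‖∑ s, ψ (f s)‖ ^ 2 : ℝ) : ℂ)
      = ((Fintype.card G * ∑ p : G, (#{s | f s = p} : ℝ) ^ 2 : ℝ) : ℂ) := by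
    push_cast
    simp_rw [hexp, hcoll]
    rw [Finset.sum_comm, Finset.mul_sum]
    refine Finset.sum_congr rfl fun s _ => ?_
    rw [Finset.sum_comm, Finset.mul_sum]
    refine Finset.sum_congr rfl fun t _ => ?_
    rw [AddChar.sum_apply_eq_ite]
    simp [sub_eq_zero]
  exact_mod_cast this

open Finset in
/-- **XOR lemma**: if all nontrivial character sums of `f` are small, then `f` maps the uniform
distribution close to the uniform distribution in `ℓ¹`-norm. -/
theorem sum_abs_density_sub_le {S G : Type*} [Fintype S] [Nonempty S] [AddCommGroup G] [Fintype G]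
    [DecidableEq G] (f : S → G) {B : ℝ} (hB₀ : 0 ≤ B)
    (hB : ∀ ψ : AddChar G ℂ, ψ ≠ 1 → ‖∑ s, ψ (f s)‖ ^ 2 ≤ B * (Fintype.card S : ℝ) ^ 2) :
    ∑ p : G, |(#{s | f s = p} : ℝ) / Fintype.card S - 1 / Fintype.card G|
      ≤ √(Fintype.card G * B) := by
  classical
  have hS : (Fintype.card S : ℝ) ≠ 0 := Nat.cast_ne_zero.2 Fintype.card_ne_zero
  have hG : (0 : ℝ) < Fintype.card G := Nat.cast_pos.2 Fintype.card_pos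
  have hsum : ∑ p : G, (#{s | f s = p} : ℝ) = Fintype.card S := by
    have := Finset.card_eq_sum_card_fiberwise (f := f) (s := univ) (t := univ) (by simp)
    rw [← Finset.card_univ, this]
    push_cast
    rfl
  have hpars := sum_norm_sq_charSum f
  rw [← Finset.add_sum_erase _ _ (Finset.mem_univ (1 : AddChar G ℂ))] at hpars
  have hrest : ∑ ψ ∈ univ.erase (1 : AddChar G ℂ), ‖∑ s, ψ (f s)‖ ^ 2
      ≤ Fintype.card G * (B * (Fintype.card S : ℝ) ^ 2) := by
    refine (Finset.sum_le_card_nsmul _ _ _ fun ψ hψ => hB ψ (Finset.ne_of_mem_erase hψ)).trans ?_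
    rw [nsmul_eq_mul]
    refine mul_le_mul_of_nonneg_right ?_ (by positivity)
    have := Finset.card_le_univ (univ.erase (1 : AddChar G ℂ))
    rw [AddChar.card_eq] at this
    exact_mod_cast this
  have htriv : ‖∑ s, (1 : AddChar G ℂ) (f s)‖ ^ 2 = (Fintype.card S : ℝ) ^ 2 := by simp
  have hvar : ∑ p : G, |(#{s | f s = p} : ℝ) / Fintype.card S - 1 / Fintype.card G| ^ 2
      = (∑ p : G, (#{s | f s = p} : ℝ) ^ 2) / (Fintype.card S : ℝ) ^ 2
        - 1 / Fintype.card G := by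
    have (p : G) : |(#{s | f s = p} : ℝ) / Fintype.card S - 1 / Fintype.card G| ^ 2
        = (#{s | f s = p} : ℝ) ^ 2 / (Fintype.card S : ℝ) ^ 2
          - 2 / (Fintype.card S * Fintype.card G) * (#{s | f s = p} : ℝ)
          + 1 / (Fintype.card G : ℝ) ^ 2 := by
      rw [sq_abs]
      field_simp
      ring
    simp_rw [this]
    rw [Finset.sum_add_distrib, Finset.sum_sub_distrib, ← Finset.mul_sum, hsum, ← Finset.sum_div,
      Finset.sum_const, Finset.card_univ, nsmul_eq_mul]
    field_simp
    ring
  have hvar_le : ∑ p : G, |(#{s | f s = p} : ℝ) / Fintype.card S - 1 / Fintype.card G| ^ 2 ≤ B := by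
    have : ∑ p : G, (#{s | f s = p} : ℝ) ^ 2
        ≤ (B + 1 / Fintype.card G) * (Fintype.card S : ℝ) ^ 2 := by
      rw [← mul_le_mul_iff_right₀ hG, ← hpars, htriv]
      have : (Fintype.card G : ℝ) * ((B + 1 / Fintype.card G) * (Fintype.card S : ℝ) ^ 2)
          = (Fintype.card S : ℝ) ^ 2 + Fintype.card G * (B * (Fintype.card S : ℝ) ^ 2) := by
        field_simp
        ring
      linarith
    rw [hvar, sub_le_iff_le_add, div_le_iff₀ (by positivity)]
    exact this
  refine Real.le_sqrt_of_sq_le (sq_sum_le_card_mul_sum_sq.trans ?_)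
  rw [Finset.card_univ]
  exact mul_le_mul_of_nonneg_left hvar_le hG.le

/-- The character sum of a subset-sum map factors over the coordinates. -/
theorem charSum_subsetSum {G : Type*} [AddCommGroup G] {n : ℕ} (w : Fin n → G)
    (ψ : AddChar G ℂ) :
    ∑ s : Fin n → Fin 2, ψ (∑ i, (s i : ℕ) • w i) = ∏ i, (1 + ψ (w i)) := by
  have (i : Fin n) : 1 + ψ (w i) = ∑ b : Fin 2, ψ ((b : ℕ) • w i) := by
    simp [Fin.sum_univ_two]
  simp_rw [this, Finset.prod_univ_sum, Fintype.piFinset_univ]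
  refine Finset.sum_congr rfl fun s _ => ?_
  induction (Finset.univ : Finset (Fin n)) using Finset.induction_on with
  | empty => simp
  | insert i t hi ih => rw [Finset.sum_insert hi, Finset.prod_insert hi, AddChar.map_add_eq_mul, ih]

/-- Every character of `(ZMod q)^ℓ` is given by pairing with a vector. -/
theorem exists_eq_stdAddChar_dotProduct {q ℓ : ℕ} [NeZero q]
    (ψ : AddChar (Fin ℓ → ZMod q) ℂ) :
    ∃ x : Fin ℓ → ZMod q, ∀ v, ψ v = ZMod.stdAddChar (x ⬝ᵥ v) := by
  have hsurj : Function.Surjective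
      (fun a : ZMod q => AddChar.mulShift (ZMod.stdAddChar : AddChar (ZMod q) ℂ) a) := by
    have hinj := AddChar.to_mulShift_inj_of_isPrimitive (ZMod.isPrimitive_stdAddChar q)
    exact ((Fintype.bijective_iff_injective_and_card _).2 ⟨hinj, AddChar.card_eq.symm⟩).2
  choose x hx using fun j => hsurj
    (ψ.compAddMonoidHom (AddMonoidHom.single (fun _ : Fin ℓ => ZMod q) j))
  refine ⟨x, fun v => ?_⟩
  have hj (j : Fin ℓ) : ψ (Pi.single j (v j)) = ZMod.stdAddChar (x j * v j) := by
    simpa [AddChar.mulShift_apply] using (DFunLike.congr_fun (hx j) (v j)).symm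
  conv_lhs => rw [← Finset.univ_sum_single v]
  rw [dotProduct]
  induction (Finset.univ : Finset (Fin ℓ)) using Finset.induction_on with
  | empty => simp
  | insert j t hj' ih =>
    rw [Finset.sum_insert hj', Finset.sum_insert hj', AddChar.map_add_eq_mul,
      AddChar.map_add_eq_mul, ih, hj]

theorem re_stdAddChar {q : ℕ} [NeZero q] (x : ZMod q) :
    (ZMod.stdAddChar x : ℂ).re = Real.cos (2 * Real.pi * |(x.valMinAbs : ℝ)| / q) := by
  have h := ZMod.stdAddChar_coe (N := q) x.valMinAbs
  rw [ZMod.coe_valMinAbs] at h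
  have harg : (2 * Real.pi * Complex.I * (x.valMinAbs : ℂ) / q : ℂ)
      = ((2 * Real.pi * x.valMinAbs / q : ℝ) : ℂ) * Complex.I := by
    push_cast
    ring
  rw [h, harg, Complex.exp_ofReal_mul_I_re, ← Real.cos_abs]
  congr 1
  rw [abs_div, abs_mul, abs_of_pos Real.two_pi_pos, Nat.abs_cast]

theorem ModerateElem.abs_re_stdAddChar_le {q : ℕ} [NeZero q] {x : ZMod q}
    (hx : ModerateElem q x) : |(ZMod.stdAddChar x : ℂ).re| ≤ √2 / 2 := by
  have hq : (0 : ℝ) < q := Nat.cast_pos.2 (NeZero.pos q)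
  have hlo : (q : ℝ) < 8 * |(x.valMinAbs : ℝ)| := by exact_mod_cast hx.1
  have hhi : 8 * |(x.valMinAbs : ℝ)| ≤ 3 * q := by exact_mod_cast hx.2
  have hpi := Real.pi_pos
  have h₁ : Real.pi / 4 ≤ 2 * Real.pi * |(x.valMinAbs : ℝ)| / q := by
    rw [le_div_iff₀ hq]
    nlinarith
  have h₂ : 2 * Real.pi * |(x.valMinAbs : ℝ)| / q ≤ Real.pi - Real.pi / 4 := by
    rw [div_le_iff₀ hq]
    nlinarith
  rw [re_stdAddChar, abs_le, ← Real.cos_pi_div_four, ← Real.cos_pi_sub]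
  exact ⟨Real.cos_le_cos_of_nonneg_of_le_pi (by linarith) (by linarith) h₂,
    Real.cos_le_cos_of_nonneg_of_le_pi (by linarith) (by linarith) h₁⟩

theorem ModerateElem.norm_sq_one_add_le {q : ℕ} [NeZero q] {x : ZMod q}
    (hx : ModerateElem q x) {ε : ℂ} (hε : ε = 1 ∨ ε = -1) :
    ‖1 + ZMod.stdAddChar x * ε‖ ^ 2 ≤ 4 * (2 : ℝ) ^ (-(1 : ℝ) / 5) := by
  have hnorm : Complex.normSq (ZMod.stdAddChar x) = 1 := by
    rw [Complex.normSq_eq_norm_sq, AddChar.norm_apply, one_pow]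
  have hroot : (2 + √2) / 4 ≤ (2 : ℝ) ^ (-(1 : ℝ) / 5) := by
    refine le_of_pow_le_pow_left₀ (n := 5) (by norm_num) (by positivity) ?_
    rw [← Real.rpow_natCast ((2 : ℝ) ^ _), ← Real.rpow_mul (by norm_num)]
    norm_num [Real.rpow_neg_one]
    have hs : √2 ≤ 1.415 := (Real.sqrt_le_left (by norm_num)).2 (by norm_num)
    calc ((2 + √2) / 4) ^ 5 ≤ ((2 + 1.415) / 4) ^ 5 := by gcongr
      _ ≤ 1 / 2 := by norm_num
  obtain ⟨hlo, hhi⟩ := abs_le.1 hx.abs_re_stdAddChar_le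
  rw [← Complex.normSq_eq_norm_sq, Complex.normSq_add]
  rcases hε with rfl | rfl <;> simp [hnorm] <;> linarith

/-- If `a`, `b` and `c` are elements of `(ZMod 2)²` with `a.1 ≠ 0`, `b.2 ≠ 0` and `c.1 ≠ c.2`, then
they generate `(ZMod 2)²`. -/
theorem exists_combination_zmod_two :
    ∀ a b c : ZMod 2 × ZMod 2, a.1 ≠ 0 → b.2 ≠ 0 → c.1 ≠ c.2 →
      ∀ z, ∃ k l m : Fin 2, z = (k : ℕ) • a + (l : ℕ) • b + (m : ℕ) • c := by
  decide

theorem exists_charTwo_ne_one {n : ℕ} {d₁ d₂ : Fin n → ZMod 2} (hne : d₁ ≠ d₂) (h₁ : d₁ ≠ 0)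
    (h₂ : d₂ ≠ 0) {ε : AddChar (ZMod 2 × ZMod 2) ℂ} (hε : ε ≠ 1) :
    ∃ i, ε (d₁ i, d₂ i) ≠ 1 := by
  by_contra! h
  obtain ⟨i, hi⟩ := Function.ne_iff.1 h₁
  obtain ⟨j, hj⟩ := Function.ne_iff.1 h₂
  obtain ⟨k, hk⟩ := Function.ne_iff.1 hne
  refine hε (DFunLike.ext _ _ fun z => ?_)
  obtain ⟨l, m, r, rfl⟩ := exists_combination_zmod_two (d₁ i, d₂ i) (d₁ j, d₂ j) (d₁ k, d₂ k)
    hi hj hk z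
  simp only [AddChar.map_add_eq_mul, AddChar.map_nsmul_eq_pow, h, one_pow, mul_one,
    AddChar.one_apply]

theorem charTwo_eq_one_or_neg_one (ε : AddChar (ZMod 2 × ZMod 2) ℂ) (z : ZMod 2 × ZMod 2) :
    ε z = 1 ∨ ε z = -1 := by
  rw [← sq_eq_one_iff, ← AddChar.map_nsmul_eq_pow, show 2 • z = 0 by revert z; decide,
    AddChar.map_zero_eq_one]

theorem ModerateVec.prod_norm_sq_one_add_le {q n : ℕ} [NeZero q] {v : Fin n → ZMod q}
    (hv : ModerateVec q v) {ε : Fin n → ℂ} (hε : ∀ i, ε i = 1 ∨ ε i = -1) :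
    ∏ i, ‖1 + ZMod.stdAddChar (v i) * ε i‖ ^ 2 ≤ (2 : ℝ) ^ (-(n : ℝ) / 20) * (2 ^ n) ^ 2 := by
  classical
  obtain ⟨M, hM, hmod⟩ := hv
  have htriv (i : Fin n) : ‖1 + ZMod.stdAddChar (v i) * ε i‖ ^ 2 ≤ 4 := by
    have hε' : ‖ε i‖ = 1 := by rcases hε i with h | h <;> simp [h]
    have : ‖1 + ZMod.stdAddChar (v i) * ε i‖ ≤ 2 := by
      refine (norm_add_le _ _).trans ?_
      rw [norm_mul, AddChar.norm_apply, hε', norm_one]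
      norm_num
    nlinarith [norm_nonneg (1 + ZMod.stdAddChar (v i) * ε i)]
  have hdecay : ((2 : ℝ) ^ (-(1 : ℝ) / 5)) ^ M.card ≤ (2 : ℝ) ^ (-(n : ℝ) / 20) := by
    rw [← Real.rpow_natCast ((2 : ℝ) ^ _), ← Real.rpow_mul (by norm_num)]
    refine Real.rpow_le_rpow_of_exponent_le (by norm_num) ?_
    have : (n : ℝ) ≤ 4 * M.card := by exact_mod_cast hM
    linarith
  calc ∏ i, ‖1 + ZMod.stdAddChar (v i) * ε i‖ ^ 2
      ≤ ∏ i, 4 * (if i ∈ M then (2 : ℝ) ^ (-(1 : ℝ) / 5) else 1) := by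
        refine Finset.prod_le_prod (fun i _ => by positivity) fun i _ => ?_
        split_ifs with hi
        · exact (hmod i hi).norm_sq_one_add_le (hε i)
        · simpa using htriv i
    _ = ((2 : ℝ) ^ (-(1 : ℝ) / 5)) ^ M.card * (2 ^ n) ^ 2 := by
        rw [Finset.prod_mul_distrib, Finset.prod_ite_mem, Finset.univ_inter, Finset.prod_const,
          Finset.prod_const, Finset.card_univ, Fintype.card_fin, ← pow_mul, mul_comm n 2, pow_mul,
          mul_comm]
        norm_num
    _ ≤ _ := by gcongr

theorem norm_sq_prod_one_add_le {q ℓ n : ℕ} [NeZero q] {C : Matrix (Fin ℓ) (Fin n) (ZMod q)}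
    (hC : ModerateMatrix q C) {d₁ d₂ : Fin n → ZMod 2} (hne : d₁ ≠ d₂) (h₁ : d₁ ≠ 0)
    (h₂ : d₂ ≠ 0) {ψ : AddChar ((Fin ℓ → ZMod q) × ZMod 2 × ZMod 2) ℂ} (hψ : ψ ≠ 1) :
    ‖∏ i, (1 + ψ (C.col i, d₁ i, d₂ i))‖ ^ 2 ≤ (2 : ℝ) ^ (-(n : ℝ) / 20) * (2 ^ n) ^ 2 := by
  obtain ⟨x, hx⟩ := exists_eq_stdAddChar_dotProduct (ψ.compAddMonoidHom (AddMonoidHom.inl _ _))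
  set ε := ψ.compAddMonoidHom (AddMonoidHom.inr _ _) with hε
  have hfactor (v : Fin ℓ → ZMod q) (z : ZMod 2 × ZMod 2) :
      ψ (v, z) = ZMod.stdAddChar (x ⬝ᵥ v) * ε z := by
    rw [← hx, hε, AddChar.compAddMonoidHom_apply, AddChar.compAddMonoidHom_apply,
      ← AddChar.map_add_eq_mul]
    simp
  by_cases hx₀ : x = 0
  · have hε₁ : ε ≠ 1 := by
      intro h
      refine hψ (DFunLike.ext _ _ fun p => ?_)
      rw [← Prod.mk.eta (p := p), hfactor, hx₀, h]
      simp
    obtain ⟨i, hi⟩ := exists_charTwo_ne_one hne h₁ h₂ hε₁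
    have hneg := (charTwo_eq_one_or_neg_one ε _).resolve_left hi
    have hzero : 1 + ψ (C.col i, d₁ i, d₂ i) = 0 := by
      rw [hfactor, hneg, hx₀]
      simp
    rw [Finset.prod_eq_zero (Finset.mem_univ i) hzero, norm_zero,
      zero_pow two_ne_zero]
    positivity
  · rw [norm_prod, ← Finset.prod_pow]
    simp_rw [hfactor]
    exact (hC x hx₀).prod_norm_sq_one_add_le fun i => charTwo_eq_one_or_neg_one ε _

/-- For `q` prime, a moderate matrix `C`, and distinct nonzero binary vectors
`d'₁ ≠ d'₂`, the joint distribution of `(C·s, d'₁·s, d'₂·s)` for uniformly random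
`s ∈ {0,1}ⁿ` is within total variation distance `q^{ℓ/2} · 2^{-n/40}` of uniform. -/
theorem two_vector_lhl_moderate (q : ℕ) [NeZero q] (hq : q.Prime)
    (ℓ n : ℕ) (hℓ : 1 ≤ ℓ) (hn : 1 ≤ n)
    (C : Matrix (Fin ℓ) (Fin n) (ZMod q)) (hC : ModerateMatrix q C)
    (d₁ d₂ : Fin n → ZMod 2) (hne : d₁ ≠ d₂) (h₁ : d₁ ≠ 0) (h₂ : d₂ ≠ 0) :
    (1 / 2 : ℝ) * ∑ p : (Fin ℓ → ZMod q) × ZMod 2 × ZMod 2,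
        |gDensity q ℓ n C d₁ d₂ p - 1 / (4 * (q : ℝ) ^ ℓ)|
      ≤ (q : ℝ) ^ ((ℓ : ℝ) / 2) * (2 : ℝ) ^ (-(n : ℝ) / 40) := by
  classical
  have hq₀ : (0 : ℝ) < q := Nat.cast_pos.2 hq.pos
  have hsum (s : Fin n → Fin 2) :
      ∑ i, (s i : ℕ) • ((C.col i, d₁ i, d₂ i) : (Fin ℓ → ZMod q) × ZMod 2 × ZMod 2)
        = (C.mulVec (fun i => ((s i : ℕ) : ZMod q)), ∑ i, d₁ i * ((s i : ℕ) : ZMod 2),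
            ∑ i, d₂ i * ((s i : ℕ) : ZMod 2)) := by
    refine Prod.ext ?_ (Prod.ext ?_ ?_)
    · ext j
      simp [Prod.fst_sum, Matrix.mulVec, dotProduct, mul_comm]
    · simp [Prod.fst_sum, Prod.snd_sum, mul_comm]
    · simp [Prod.snd_sum, mul_comm]
  have hmain := sum_abs_density_sub_le
    (fun s : Fin n → Fin 2 =>
      ∑ i, (s i : ℕ) • ((C.col i, d₁ i, d₂ i) : (Fin ℓ → ZMod q) × ZMod 2 × ZMod 2))
    (B := (2 : ℝ) ^ (-(n : ℝ) / 20)) (by positivity) fun ψ hψ => by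
      rw [charSum_subsetSum]
      simpa using norm_sq_prod_one_add_le hC hne h₁ h₂ hψ
  have hS : (Fintype.card (Fin n → Fin 2) : ℝ) = 2 ^ n := by simp
  have hG : (Fintype.card ((Fin ℓ → ZMod q) × ZMod 2 × ZMod 2) : ℝ) = 4 * (q : ℝ) ^ ℓ := by
    simp only [Fintype.card_prod, Fintype.card_fun, ZMod.card, Fintype.card_fin]
    push_cast
    ring
  have hsqrt : √(4 * (q : ℝ) ^ ℓ * (2 : ℝ) ^ (-(n : ℝ) / 20))
      = 2 * ((q : ℝ) ^ ((ℓ : ℝ) / 2) * (2 : ℝ) ^ (-(n : ℝ) / 40)) := by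
    rw [Real.sqrt_eq_iff_mul_self_eq (by positivity) (by positivity)]
    have hqpow : (q : ℝ) ^ ((ℓ : ℝ) / 2) * (q : ℝ) ^ ((ℓ : ℝ) / 2) = (q : ℝ) ^ ℓ := by
      rw [← Real.rpow_add hq₀, add_halves, Real.rpow_natCast]
    have htwo : (2 : ℝ) ^ (-(n : ℝ) / 40) * (2 : ℝ) ^ (-(n : ℝ) / 40)
        = (2 : ℝ) ^ (-(n : ℝ) / 20) := by
      rw [← Real.rpow_add (by norm_num)]
      ring_nf
    rw [← hqpow, ← htwo]
    ring
  rw [hS, hG, hsqrt] at hmain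
  have hdens (p : (Fin ℓ → ZMod q) × ZMod 2 × ZMod 2) : gDensity q ℓ n C d₁ d₂ p
      = ((Finset.univ.filter fun s : Fin n → Fin 2 =>
          ∑ i, (s i : ℕ) • ((C.col i, d₁ i, d₂ i) : (Fin ℓ → ZMod q) × ZMod 2 × ZMod 2)
            = p).card : ℝ) / 2 ^ n := by
    simp only [gDensity, hsum, Prod.ext_iff]
  simp_rw [hdens]
  linarith
end

section
/- Let q ≥ 2 and n ≥ 1 be integers and w = ⌈log₂ q⌉, and let J : ZMod q → (Fin w → ZMod 2) denote binary decomposition (J(x) is the bit string of the unique representative of x in {0, …, q−1}). Let x₀ : Fin n → ZMod q, let s : Fin n → ZMod 2, and let x₁ : Fin n → ZMod q be given by x₁ i = x₀ i − (s i cast into ZMod q). Let d consist of a bit d₀ ∈ ZMod 2 together with blocks d[1], …, d[n] ∈ (Fin w → ZMod 2), and for each i define d'ᵢ = d[i] · (J(x₀ i) + J(x₀ i − 1)) ∈ ZMod 2. Then d₀ + ∑ᵢ d[i] · (J(x₀ i) + J(x₁ i)) = d₀ + ∑ᵢ d'ᵢ · s i in ZMod 2; that is, d · (1, J(x₀) ⊕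 J(x₁)) = d₀ + d' · s (mod 2). -/
/-- The mod-2 inner product `u · v = ∑ j, uⱼ vⱼ ∈ ZMod 2`. -/
def dotp {m : ℕ} (u v : Fin m → ZMod 2) : ZMod 2 := ∑ j, u j * v j

/-- The binary decomposition `J : ZMod q → (Fin ⌈log₂ q⌉ → ZMod 2)`, sending `x`
to the bit string of its representative in `{0, …, q-1}`. -/
def binDecomp (q : ℕ) (x : ZMod q) : Fin (Nat.clog 2 q) → ZMod 2 :=
  fun j => if Nat.testBit (ZMod.val x) (j : ℕ) then 1 else 0

/-- The identity underlying the algorithm `Good` of the LWE-based NTCF family: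
if `x₁ = x₀ - s` componentwise (with the binary secret `s` cast into `ZMod q`),
then `d₀ + ∑ᵢ d[i]·(J(x₀ i) ⊕ J(x₁ i)) = d₀ + d'·s (mod 2)`, where
`d'ᵢ = d[i]·(J(x₀ i) ⊕ J(x₀ i - 1))`. -/
theorem good_equation (q : ℕ) (hq : 2 ≤ q) (n : ℕ) (hn : 1 ≤ n)
    (x₀ x₁ : Fin n → ZMod q) (s : Fin n → ZMod 2)
    (hx₁ : ∀ i, x₁ i = x₀ i - (((s i).val : ℕ) : ZMod q))
    (d₀ : ZMod 2) (dblk : Fin n → Fin (Nat.clog 2 q) → ZMod 2)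
    (d' : Fin n → ZMod 2)
    (hd' : ∀ i, d' i = dotp (dblk i) (binDecomp q (x₀ i) + binDecomp q (x₀ i - 1))) :
    d₀ + ∑ i, dotp (dblk i) (binDecomp q (x₀ i) + binDecomp q (x₁ i))
      = d₀ + ∑ i, d' i * s i := by
  congr 1
  refine Finset.sum_congr rfl fun i _ => ?_
  rw [hx₁, hd']
  have hs : ∀ t : ZMod 2, t = 0 ∨ t = 1 := by decide
  rcases hs (s i) with h | h
  · simp [h, dotp, CharTwo.add_self_eq_zero]
  · simp [h, ZMod.val_one]
end
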